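/- For all b, b' ∈ 𝓑', the ℂ-vector spaces Hom_R(R_b, R_{b'}) and Hom_R(R_{b'}, R_b) are isomorphic; both have ℂ-dimension ∏_{i=1}^n min(b_i, b'_i). -/

import Mathlib

open MvPolynomial

/-- The complete homogeneous symmetric polynomial of degree `j` in the variables indexed
by the finite set `S`. -/
noncomputable def hset (n : ℕ) (S : Finset (Fin n)) (j : ℕ) : MvPolynomial (Fin n) ℂ :=
  ∑ μ ∈ Finset.univ.filter (fun μ : Sym (Fin n) j => ∀ i ∈ μ, i ∈ S),
    (μ.val.map MvPolynomial.X).prod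

/-- The complete homogeneous symmetric polynomial `h_j(x_1, …, x_k)` of degree `j` in the
first `k` variables (these are the 0-based indices `0, …, k-1`). -/
noncomputable def hfirst (n k j : ℕ) : MvPolynomial (Fin n) ℂ :=
  hset n (Finset.univ.filter (fun i : Fin n => (i : ℕ) < k)) j

/-- The ideal `I_b` generated by `h_{b_1}(x_1), h_{b_2}(x_1,x_2), …, h_{b_n}(x_1,…,x_n)`. -/
noncomputable def Ib {n : ℕ} (b : Fin n → ℕ) : Ideal (MvPolynomial (Fin n) ℂ) :=
  Ideal.span (Set.range fun i : Fin n => hfirst n ((i : ℕ) + 1) (b i))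

/-- `b ∈ 𝓑'`: a sequence of positive integers with `b i ≥ b (i+1) ≥ b i - 1` for all `i`. -/
def Bprime {n : ℕ} (b : Fin n → ℕ) : Prop :=
  (∀ i, 0 < b i) ∧ ∀ (i : ℕ) (h : i + 1 < n),
    b ⟨i + 1, h⟩ ≤ b ⟨i, Nat.lt_of_succ_lt h⟩ ∧
      b ⟨i, Nat.lt_of_succ_lt h⟩ ≤ b ⟨i + 1, h⟩ + 1


theorem hfirst_zero (n k : ℕ) : hfirst n k 0 = 1 := by
  unfold hfirst hset
  rw [Finset.filter_true_of_mem, Fintype.sum_unique]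
  · simp [Sym.eq_nil_of_card_zero]
  · intro μ _ i hi
    rw [Sym.eq_nil_of_card_zero μ] at hi
    exact absurd hi (Sym.notMem_nil i)

theorem hset_insert {n : ℕ} (S : Finset (Fin n)) (a : Fin n) (ha : a ∉ S) (j : ℕ) :
    hset n (insert a S) (j + 1) = hset n S (j + 1) + X a * hset n (insert a S) j := by
  unfold hset
  rw [← Finset.sum_filter_not_add_sum_filter _ (fun μ : Sym (Fin n) (j + 1) => a ∈ μ),
    Finset.filter_filter, Finset.filter_filter, Finset.mul_sum]
  congr 1
  · refine Finset.sum_congr (Finset.filter_congr fun μ _ => ?_) fun _ _ => rfl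
    constructor
    · rintro ⟨h1, h2⟩ i hi
      refine (Finset.mem_insert.1 (h1 i hi)).resolve_left ?_
      rintro rfl
      exact h2 hi
    · exact fun h => ⟨fun i hi => Finset.mem_insert_of_mem (h i hi), fun h2 => ha (h a h2)⟩
  · symm
    refine Finset.sum_bij (fun μ _ => a ::ₛ μ) ?_ ?_ ?_ ?_
    · intro μ hμ
      simp only [Finset.mem_filter, Finset.mem_univ, true_and] at hμ ⊢
      refine ⟨fun i hi => ?_, Sym.mem_cons_self a μ⟩
      rcases Sym.mem_cons.1 hi with rfl | hi
      · exact Finset.mem_insert_self _ _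
      · exact hμ i hi
    · intro μ _ ν _ h
      exact Sym.cons_inj_right a μ ν |>.1 h
    · intro μ hμ
      simp only [Finset.mem_filter, Finset.mem_univ, true_and] at hμ
      obtain ⟨ν, rfl⟩ := Sym.exists_cons_of_mem hμ.2
      refine ⟨ν, ?_, rfl⟩
      simp only [Finset.mem_filter, Finset.mem_univ, true_and]
      exact fun i hi => hμ.1 i (Sym.mem_cons_of_mem hi)
    · intro μ _
      simp [Sym.cons]

theorem hfirst_succ_succ {n : ℕ} (k : Fin n) (j : ℕ) :
    hfirst n (k + 1) (j + 1) = hfirst n k (j + 1) + X k * hfirst n (k + 1) j := by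
  have h : (Finset.univ.filter fun i : Fin n => (i : ℕ) < k + 1) =
      insert k (Finset.univ.filter fun i : Fin n => (i : ℕ) < k) := by
    ext i
    simp only [Finset.mem_filter, Finset.mem_univ, true_and, Finset.mem_insert, Fin.ext_iff]
    omega
  unfold hfirst
  rw [h]
  exact hset_insert _ _ (by simp) _

theorem hfirst_zero_succ (n j : ℕ) : hfirst n 0 (j + 1) = 0 := by
  unfold hfirst hset
  refine Finset.sum_eq_zero fun μ hμ => ?_
  obtain ⟨a, ν, rfl⟩ := Sym.exists_eq_cons_of_succ μ
  have := (Finset.mem_filter.1 hμ).2 a (Sym.mem_cons_self a ν)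
  simp at this

theorem rename_castSucc_hfirst {n : ℕ} (k : ℕ) (hk : k ≤ n) (j : ℕ) :
    rename Fin.castSucc (hfirst n k j) = hfirst (n + 1) k j := by
  induction k generalizing j with
  | zero =>
    cases j with
    | zero => simp [hfirst_zero]
    | succ j => simp [hfirst_zero_succ]
  | succ k ihk =>
    induction j with
    | zero => simp [hfirst_zero]
    | succ j ihj =>
      have h1 := hfirst_succ_succ (⟨k, hk⟩ : Fin n) j
      have h2 := hfirst_succ_succ (⟨k, by omega⟩ : Fin (n + 1)) j
      simp only at h1 h2
      rw [h1, h2, map_add, map_mul, ihk (by omega), ihj, rename_X]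
      rfl

theorem hfirst_mem_Ib {n : ℕ} {b : Fin n → ℕ}
    (hb : ∀ (i : ℕ) (h : i + 1 < n), b ⟨i, Nat.lt_of_succ_lt h⟩ ≤ b ⟨i + 1, h⟩ + 1)
    (k : ℕ) (hk : k < n) (j : ℕ) (hj : b ⟨k, hk⟩ ≤ j) :
    hfirst n (k + 1) j ∈ Ib b := by
  induction k generalizing j with
  | zero =>
    induction j, hj using Nat.le_induction with
    | base => exact Ideal.subset_span ⟨⟨0, hk⟩, rfl⟩
    | succ j hj ihj =>
      rw [hfirst_succ_succ (⟨0, hk⟩ : Fin n) j, hfirst_zero_succ, zero_add]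
      exact Ideal.mul_mem_left _ _ ihj
  | succ k ihk =>
    induction j, hj using Nat.le_induction with
    | base => exact Ideal.subset_span ⟨⟨k + 1, hk⟩, rfl⟩
    | succ j hj ihj =>
      rw [hfirst_succ_succ (⟨k + 1, hk⟩ : Fin n) j]
      exact add_mem (ihk _ _ ((hb k hk).trans (by omega))) (Ideal.mul_mem_left _ _ ihj)

theorem Ib_sup_Ib {n : ℕ} {b b' : Fin n → ℕ} (hb : Bprime b) (hb' : Bprime b') :
    Ib b ⊔ Ib b' = Ib fun i => min (b i) (b' i) := by
  have hmin : ∀ (i : ℕ) (h : i + 1 < n),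
      min (b ⟨i, Nat.lt_of_succ_lt h⟩) (b' ⟨i, Nat.lt_of_succ_lt h⟩) ≤
        min (b ⟨i + 1, h⟩) (b' ⟨i + 1, h⟩) + 1 := by
    intro i h
    have h1 := (hb.2 i h).2
    have h2 := (hb'.2 i h).2
    omega
  apply le_antisymm
  · refine sup_le (Ideal.span_le.2 ?_) (Ideal.span_le.2 ?_)
    · rintro _ ⟨i, rfl⟩
      exact hfirst_mem_Ib hmin i i.2 _ (min_le_left _ _)
    · rintro _ ⟨i, rfl⟩
      exact hfirst_mem_Ib hmin i i.2 _ (min_le_right _ _)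
  · refine Ideal.span_le.2 ?_
    rintro _ ⟨i, rfl⟩
    rcases min_choice (b i) (b' i) with h | h
    · exact Ideal.mem_sup_left (Ideal.subset_span ⟨i, by simp only [h]⟩)
    · exact Ideal.mem_sup_right (Ideal.subset_span ⟨i, by simp only [h]⟩)

theorem Ib_succ {n : ℕ} (b : Fin (n + 1) → ℕ) :
    Ib b = (Ib (b ∘ Fin.castSucc)).map (rename Fin.castSucc) ⊔
      Ideal.span {hfirst (n + 1) (n + 1) (b (Fin.last n))} := by
  have h : ∀ i : Fin n, rename Fin.castSucc (hfirst n (i + 1) (b i.castSucc)) =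
      hfirst (n + 1) (i + 1) (b i.castSucc) := fun i => rename_castSucc_hfirst _ i.2 _
  unfold Ib
  rw [Ideal.map_span, ← Ideal.span_union, ← Set.range_comp]
  congr 1
  ext p
  rw [Set.mem_union, Set.mem_range, Set.mem_range, Set.mem_singleton_iff]
  constructor
  · rintro ⟨i, rfl⟩
    induction i using Fin.lastCases with
    | last => exact Or.inr rfl
    | cast i => exact Or.inl ⟨i, h i⟩
  · rintro (⟨i, rfl⟩ | rfl)
    · exact ⟨i.castSucc, (h i).symm⟩
    · exact ⟨Fin.last n, rfl⟩

/-- Polynomials in `n + 1` variables, seen as polynomials in the last variable. -/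
noncomputable def lastVarEquiv (n : ℕ) :
    MvPolynomial (Fin (n + 1)) ℂ ≃ₐ[ℂ] Polynomial (MvPolynomial (Fin n) ℂ) :=
  (renameEquiv ℂ finSuccEquivLast).trans (optionEquivLeft ℂ (Fin n))

theorem lastVarEquiv_rename_castSucc {n : ℕ} (p : MvPolynomial (Fin n) ℂ) :
    lastVarEquiv n (rename Fin.castSucc p) = Polynomial.C p := by
  have : (lastVarEquiv n).toAlgHom.comp (rename Fin.castSucc) = Polynomial.CAlgHom := by
    ext i
    simp [lastVarEquiv]
  exact DFunLike.congr_fun this p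

theorem lastVarEquiv_X_last (n : ℕ) : lastVarEquiv n (X (Fin.last n)) = Polynomial.X := by
  simp [lastVarEquiv]

theorem lastVarEquiv_hfirst (n j : ℕ) :
    (lastVarEquiv n (hfirst (n + 1) (n + 1) j)).Monic ∧
      (lastVarEquiv n (hfirst (n + 1) (n + 1) j)).natDegree = j := by
  induction j with
  | zero => simp [hfirst_zero]
  | succ j ih =>
    have h := hfirst_succ_succ (Fin.last n) j
    rw [Fin.val_last] at h
    rw [h, map_add, map_mul, lastVarEquiv_X_last, ← rename_castSucc_hfirst n le_rfl,
      lastVarEquiv_rename_castSucc, add_comm]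
    obtain ⟨h1, h2⟩ := ih
    have h3 := Polynomial.monic_X.mul h1
    have h4 := Polynomial.natDegree_X_mul h1.ne_zero
    rw [h2] at h4
    refine ⟨h3.add_of_left (lt_of_le_of_lt Polynomial.degree_C_le ?_), ?_⟩
    · rw [Polynomial.degree_eq_natDegree h3.ne_zero, h4]
      exact_mod_cast Nat.succ_pos j
    · rw [Polynomial.natDegree_add_C, h4]

theorem Module.nonempty_hom_equiv_dual {K R : Type*} [Field K] [CommRing R] [Algebra K R]
    (I J : Ideal R) [FiniteDimensional K (R ⧸ J)] (ε : R ⧸ J →ₗ[K] K)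
    (hε : ∀ a, (∀ c, ε (a * c) = 0) → a = 0) :
    Nonempty (((R ⧸ I) →ₗ[R] (R ⧸ J)) ≃ₗ[K] Module.Dual K (R ⧸ (I ⊔ J))) := by
  let q : R →ₗ[K] R ⧸ (I ⊔ J) := (Ideal.Quotient.mkₐ K (I ⊔ J)).toLinearMap
  have hq : Function.Surjective q := Ideal.Quotient.mk_surjective
  let F : ((R ⧸ I) →ₗ[R] (R ⧸ J)) →ₗ[K] Module.Dual K R :=
    { toFun := fun ψ => ε ∘ₗ ψ.restrictScalars K ∘ₗ (Ideal.Quotient.mkₐ K I).toLinearMap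
      map_add' := fun ψ χ => by ext; simp
      map_smul' := fun c ψ => by ext; simp }
  have hF : ∀ ψ r, F ψ r = ε (ψ 1 * Ideal.Quotient.mk J r) := by
    intro ψ r
    have : ψ (Ideal.Quotient.mk I r) = ψ 1 * Ideal.Quotient.mk J r := by
      have h := ψ.map_smul r 1
      rw [Algebra.smul_def, Algebra.smul_def, mul_one] at h
      rw [mul_comm]
      exact h
    exact congrArg ε this
  have hinj : Function.Injective F := by
    rw [injective_iff_map_eq_zero]
    intro ψ hψ
    have h1 : ψ 1 = 0 := by
      refine hε _ fun c => ?_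
      obtain ⟨r, rfl⟩ := Ideal.Quotient.mk_surjective c
      rw [← hF, hψ, LinearMap.zero_apply]
    ext
    exact h1
  have hrange : LinearMap.range F = LinearMap.range q.dualMap := by
    rw [LinearMap.range_dualMap_eq_dualAnnihilator_ker]
    ext l
    rw [Submodule.mem_dualAnnihilator]
    constructor
    · rintro ⟨ψ, rfl⟩ r hr
      have hr : r ∈ I ⊔ J := Ideal.Quotient.eq_zero_iff_mem.1 hr
      obtain ⟨i, hi, j, hj, rfl⟩ := Submodule.mem_sup.1 hr
      rw [map_add, hF ψ j, Ideal.Quotient.eq_zero_iff_mem.2 hj, mul_zero, map_zero, add_zero]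
      change ε (ψ (Ideal.Quotient.mk I i)) = 0
      rw [Ideal.Quotient.eq_zero_iff_mem.2 hi, map_zero, map_zero]
    · intro hl
      have hl' : ∀ r ∈ I ⊔ J, l r = 0 := fun r hr =>
        hl r (Ideal.Quotient.eq_zero_iff_mem.2 hr)
      let m : R ⧸ J →ₗ[K] Module.Dual K (R ⧸ J) := (LinearMap.mul K (R ⧸ J)).compr₂ ε
      have hm : Function.Surjective m := by
        refine (LinearMap.injective_iff_surjective_of_finrank_eq_finrank
          Subspace.dual_finrank_eq.symm).1 ?_
        rw [injective_iff_map_eq_zero]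
        exact fun a ha => hε a fun c => LinearMap.congr_fun ha c
      have hlr : l ∈ LinearMap.range (Ideal.Quotient.mkₐ K J).toLinearMap.dualMap := by
        rw [LinearMap.range_dualMap_eq_dualAnnihilator_ker, Submodule.mem_dualAnnihilator]
        exact fun r hr => hl' r (Ideal.mem_sup_right (Ideal.Quotient.eq_zero_iff_mem.1 hr))
      obtain ⟨l', rfl⟩ := hlr
      obtain ⟨a, rfl⟩ := hm l'
      have hval : ∀ r, (Ideal.Quotient.mkₐ K J).toLinearMap.dualMap (m a) r =
        ε (a * Ideal.Quotient.mk J r) := fun r => rfl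
      have hI : I ≤ LinearMap.ker (LinearMap.toSpanSingleton R (R ⧸ J) a) := by
        intro i hi
        rw [LinearMap.mem_ker, LinearMap.toSpanSingleton_apply]
        refine hε _ fun c => ?_
        obtain ⟨r, rfl⟩ := Ideal.Quotient.mk_surjective c
        have := hl' (i * r) (Ideal.mem_sup_left (I.mul_mem_right r hi))
        rw [hval, map_mul (Ideal.Quotient.mk J)] at this
        rw [← this, Algebra.smul_def]
        congr 1
        change Ideal.Quotient.mk J i * a * _ = _
        ring
      refine ⟨Submodule.liftQ I _ hI, ?_⟩
      ext r
      rw [hF, hval]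
      congr 2
      change (1 : R) • a = a
      exact one_smul R a
  exact ⟨(LinearEquiv.ofInjective F hinj).trans ((LinearEquiv.ofEq _ _ hrange).trans
    (LinearEquiv.ofInjective q.dualMap (LinearMap.dualMap_injective_of_surjective hq)).symm)⟩

theorem AdjoinRoot.eq_zero_of_coeff_modByMonicHom_mul {A : Type*} [CommRing A] [Nontrivial A]
    {p : Polynomial A} (hp : p.Monic) {M : Type*} [AddCommGroup M] (ε : A →+ M)
    (hε : ∀ a, (∀ c, ε (a * c) = 0) → a = 0) (a : AdjoinRoot p)
    (ha : ∀ c, ε ((AdjoinRoot.modByMonicHom hp (a * c)).coeff (p.natDegree - 1)) = 0) :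
    a = 0 := by
  set f := AdjoinRoot.modByMonicHom hp a with hf
  have haf : AdjoinRoot.mk p f = a := AdjoinRoot.mk_leftInverse hp a
  by_contra h0
  have hf0 : f ≠ 0 := fun h => h0 (by rw [← haf, h, map_zero])
  have hdeg : f.natDegree < p.natDegree := by
    obtain ⟨g, rfl⟩ := AdjoinRoot.mk_surjective a
    rw [hf, AdjoinRoot.modByMonicHom_mk]
    rw [hf, AdjoinRoot.modByMonicHom_mk] at hf0
    exact Polynomial.natDegree_lt_natDegree hf0 (Polynomial.degree_modByMonic_lt g hp)
  refine hf0 (Polynomial.leadingCoeff_eq_zero.1 (hε _ fun t => ?_))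
  have h := ha (AdjoinRoot.mk p (Polynomial.C t * Polynomial.X ^ (p.natDegree - 1 - f.natDegree)))
  have hlt : (f * (Polynomial.C t * Polynomial.X ^ (p.natDegree - 1 - f.natDegree))).natDegree <
      p.natDegree := by
    refine lt_of_le_of_lt Polynomial.natDegree_mul_le ?_
    have := Polynomial.natDegree_C_mul_X_pow_le t (p.natDegree - 1 - f.natDegree)
    omega
  rw [← haf, ← map_mul, AdjoinRoot.modByMonicHom_mk, (Polynomial.modByMonic_eq_self_iff hp).2
    (Polynomial.degree_lt_degree hlt), ← mul_assoc, Polynomial.coeff_mul_X_pow',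
    if_pos (by omega), Polynomial.coeff_mul_C] at h
  rwa [show p.natDegree - 1 - (p.natDegree - 1 - f.natDegree) = f.natDegree by omega] at h

theorem AdjoinRoot.ker_mk_comp_mapRingHom {A T : Type*} [CommRing A] [CommRing T] (φ : A →+* T)
    (hφ : Function.Surjective φ) (P : Polynomial A) :
    RingHom.ker ((AdjoinRoot.mk (P.map φ)).comp (Polynomial.mapRingHom φ)) =
      (RingHom.ker φ).map Polynomial.C ⊔ Ideal.span {P} := by
  have h : RingHom.ker (AdjoinRoot.mk (P.map φ)) =
      (Ideal.span {P}).map (Polynomial.mapRingHom φ) := by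
    rw [Ideal.map_span, Set.image_singleton]
    exact Ideal.mk_ker
  rw [← RingHom.comap_ker, h, Ideal.comap_map_of_surjective' _ (Polynomial.map_surjective φ hφ),
    Polynomial.ker_mapRingHom, sup_comm]

theorem map_lastVarEquiv_Ib {n : ℕ} (b : Fin (n + 1) → ℕ) :
    (Ib b).map (lastVarEquiv n : _ →+* Polynomial (MvPolynomial (Fin n) ℂ)) =
      (Ib (b ∘ Fin.castSucc)).map Polynomial.C ⊔
        Ideal.span {lastVarEquiv n (hfirst (n + 1) (n + 1) (b (Fin.last n)))} := by
  rw [Ib_succ, Ideal.map_sup, Ideal.map_span _ {_}, Set.image_singleton]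
  congr 1
  unfold Ib
  rw [Ideal.map_span, Ideal.map_span, Ideal.map_span, Set.image_image]
  congr 1
  exact Set.image_congr fun p _ => lastVarEquiv_rename_castSucc p

theorem exists_surjective_ker_eq_Ib (n : ℕ) (b : Fin n → ℕ) (hb : ∀ i, 0 < b i) :
    ∃ (T : Type) (_ : CommRing T) (_ : Algebra ℂ T) (φ : MvPolynomial (Fin n) ℂ →ₐ[ℂ] T),
      Function.Surjective φ ∧ RingHom.ker φ = Ib b ∧ FiniteDimensional ℂ T ∧
      Module.finrank ℂ T = ∏ i, b i ∧
      ∃ ε : T →ₗ[ℂ] ℂ, ∀ a, (∀ c, ε (a * c) = 0) → a = 0 := by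
  induction n with
  | zero =>
    refine ⟨ℂ, inferInstance, inferInstance, (isEmptyAlgEquiv ℂ (Fin 0)).toAlgHom,
      (isEmptyAlgEquiv ℂ (Fin 0)).surjective, ?_, inferInstance, by simp,
      LinearMap.id, fun a ha => by simpa using ha 1⟩
    have h : Ib b = ⊥ := by simp [Ib]
    rw [h]
    exact (RingHom.injective_iff_ker_eq_bot _).1 (isEmptyAlgEquiv ℂ (Fin 0)).injective
  | succ n ih =>
    obtain ⟨T, _, _, φ, hφ, hker, hfin, hrank, ε, hε⟩ :=
      ih (b ∘ Fin.castSucc) fun i => hb _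
    have : Nontrivial T := by
      refine Module.nontrivial_of_finrank_pos (R := ℂ) ?_
      rw [hrank]
      exact Finset.prod_pos fun i _ => hb _
    let e := lastVarEquiv n
    let P := e (hfirst (n + 1) (n + 1) (b (Fin.last n)))
    obtain ⟨hP, hPdeg⟩ := lastVarEquiv_hfirst n (b (Fin.last n))
    let p := P.map (φ : MvPolynomial (Fin n) ℂ →+* T)
    have hp : p.Monic := hP.map _
    have hpdeg : p.natDegree = b (Fin.last n) := (hP.natDegree_map _).trans hPdeg
    have : Module.Free T (AdjoinRoot p) := .of_basis (AdjoinRoot.powerBasis' hp).basis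
    have : Module.Finite T (AdjoinRoot p) := .of_basis (AdjoinRoot.powerBasis' hp).basis
    refine ⟨AdjoinRoot p, inferInstance, inferInstance,
      ((AdjoinRoot.mkₐ p).restrictScalars ℂ).comp
        ((Polynomial.mapAlgHom φ).comp e.toAlgHom), ?_, ?_, Module.Finite.trans T _, ?_,
      ε ∘ₗ ((Polynomial.lcoeff T (p.natDegree - 1)).restrictScalars ℂ) ∘ₗ
        (AdjoinRoot.modByMonicHom hp).restrictScalars ℂ, ?_⟩
    · exact AdjoinRoot.mk_surjective.comp ((Polynomial.map_surjective _ hφ).comp e.surjective)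
    · have h := AdjoinRoot.ker_mk_comp_mapRingHom (φ : MvPolynomial (Fin n) ℂ →+* T) hφ P
      have h2 : RingHom.ker (φ : MvPolynomial (Fin n) ℂ →+* T) = Ib (b ∘ Fin.castSucc) := hker
      rw [h2, ← map_lastVarEquiv_Ib] at h
      have h3 := congrArg (Ideal.comap (e : MvPolynomial (Fin (n + 1)) ℂ →+* _)) h
      rw [RingHom.comap_ker] at h3
      exact h3.trans (Ideal.comap_map_of_bijective
        (e : MvPolynomial (Fin (n + 1)) ℂ →+* Polynomial (MvPolynomial (Fin n) ℂ)) e.bijective)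
    · rw [← Module.finrank_mul_finrank ℂ T, hrank, (AdjoinRoot.powerBasis' hp).finrank,
        Fin.prod_univ_castSucc, AdjoinRoot.powerBasis'_dim, hpdeg]
      rfl
    · exact AdjoinRoot.eq_zero_of_coeff_modByMonicHom_mul hp ε.toAddMonoidHom hε

theorem Ib_finiteDimensional_finrank_and_frobenius {n : ℕ} (b : Fin n → ℕ) (hb : ∀ i, 0 < b i) :
    FiniteDimensional ℂ (MvPolynomial (Fin n) ℂ ⧸ Ib b) ∧
      Module.finrank ℂ (MvPolynomial (Fin n) ℂ ⧸ Ib b) = ∏ i, b i ∧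
      ∃ ε : (MvPolynomial (Fin n) ℂ ⧸ Ib b) →ₗ[ℂ] ℂ, ∀ a, (∀ c, ε (a * c) = 0) → a = 0 := by
  obtain ⟨T, _, _, φ, hφ, hker, hfin, hrank, ε, hε⟩ := exists_surjective_ker_eq_Ib n b hb
  rw [← hker]
  let g := Ideal.quotientKerAlgEquivOfSurjective hφ
  refine ⟨g.symm.toLinearEquiv.finiteDimensional, g.toLinearEquiv.finrank_eq.trans hrank,
    ε ∘ₗ g.toLinearMap, fun a ha => ?_⟩
  refine g.injective ((hε _ fun c => ?_).trans (map_zero g).symm)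
  have h := ha (g.symm c)
  change ε (g (a * g.symm c)) = 0 at h
  rwa [map_mul, g.apply_symm_apply] at h

/-- For `b, b' ∈ 𝓑'`, the `ℂ`-vector spaces `Hom_R(R_b, R_{b'})` and `Hom_R(R_{b'}, R_b)`
are isomorphic; both have dimension `∏ min(b_i, b'_i)` over `ℂ`. -/
theorem stmt11 {n : ℕ} (b b' : Fin n → ℕ) (hb : Bprime b) (hb' : Bprime b') :
    Nonempty
      (((MvPolynomial (Fin n) ℂ ⧸ Ib b) →ₗ[MvPolynomial (Fin n) ℂ]
          (MvPolynomial (Fin n) ℂ ⧸ Ib b')) ≃ₗ[ℂ]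
        ((MvPolynomial (Fin n) ℂ ⧸ Ib b') →ₗ[MvPolynomial (Fin n) ℂ]
          (MvPolynomial (Fin n) ℂ ⧸ Ib b))) ∧
    Module.finrank ℂ
        ((MvPolynomial (Fin n) ℂ ⧸ Ib b) →ₗ[MvPolynomial (Fin n) ℂ]
          (MvPolynomial (Fin n) ℂ ⧸ Ib b')) = ∏ i, min (b i) (b' i) ∧
    Module.finrank ℂ
        ((MvPolynomial (Fin n) ℂ ⧸ Ib b') →ₗ[MvPolynomial (Fin n) ℂ]
          (MvPolynomial (Fin n) ℂ ⧸ Ib b)) = ∏ i, min (b i) (b' i) := by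
  have hmin : ∀ i, 0 < min (b i) (b' i) := fun i => lt_min (hb.1 i) (hb'.1 i)
  obtain ⟨_, -, ε, hε⟩ := Ib_finiteDimensional_finrank_and_frobenius b hb.1
  obtain ⟨_, -, ε', hε'⟩ := Ib_finiteDimensional_finrank_and_frobenius b' hb'.1
  obtain ⟨_, hrank, -⟩ := Ib_finiteDimensional_finrank_and_frobenius _ hmin
  obtain ⟨f⟩ := Module.nonempty_hom_equiv_dual (K := ℂ) (Ib b) (Ib b') ε' hε'
  obtain ⟨g⟩ := Module.nonempty_hom_equiv_dual (K := ℂ) (Ib b') (Ib b) ε hε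
  rw [Ib_sup_Ib hb hb'] at f
  rw [sup_comm, Ib_sup_Ib hb hb'] at g
  rw [← hrank, ← Subspace.dual_finrank_eq (V := MvPolynomial (Fin n) ℂ ⧸ Ib _)]
  exact ⟨⟨f.trans g.symm⟩, f.finrank_eq, g.finrank_eq⟩
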